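/- Let H be a real Hilbert space, let A and B be bounded linear operators on H, let M and M_T be bounded positive self-adjoint operators on H, and let R be a bounded self-adjoint operator on H satisfying R ≥ r·I for some r > 0 (so R is invertible). Let T > 0 and let S : [0,T] → B(H) be a continuously differentiable family of bounded positive self-adjoint operators satisfying the backward operator Riccati differential equation −(d/dt)S(t) = A* S(t) + S(t) A − S(t) B R⁻¹ B* S(t) + M with terminal condition S(T) = M_T. Then for every t ∈ [0,T], the operator norm of S(t) satisfies ‖S(t)‖ ≤ (2‖M_T‖ + 2(T−t)‖M‖) · exp(4(T−t)‖A‖). -/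

import Mathlib

open ContinuousLinearMap RealInnerProductSpace

section

variable {H : Type*} [NormedAddCommGroup H] [InnerProductSpace ℝ H]

/-- A symmetric operator whose quadratic form lies between `0` and `C ‖v‖ ^ 2` has norm at
most `C`. -/
theorem norm_le_of_isSymmetric_of_inner_le {P : H →L[ℝ] H} (hP : P.IsSymmetric)
    (hpos : ∀ v : H, 0 ≤ ⟪P v, v⟫) {C : ℝ} (hC : 0 ≤ C)
    (hle : ∀ v : H, ⟪P v, v⟫ ≤ C * ‖v‖ ^ 2) : ‖P‖ ≤ C := by
  rw [norm_eq_iSup_rayleighQuotient P hP]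
  refine ciSup_le fun v => ?_
  have h : P.rayleighQuotient v = ⟪P v, v⟫ / ‖v‖ ^ 2 := rfl
  rw [h, abs_of_nonneg (div_nonneg (hpos v) (sq_nonneg _))]
  exact div_le_of_le_mul₀ (sq_nonneg _) hC (hle v)

theorem inner_clm_apply_self_le (P : H →L[ℝ] H) (v : H) : ⟪P v, v⟫ ≤ ‖P‖ * ‖v‖ ^ 2 := by
  calc ⟪P v, v⟫ ≤ ‖P v‖ * ‖v‖ := real_inner_le_norm _ _
    _ ≤ ‖P‖ * ‖v‖ * ‖v‖ := by gcongr; exact P.le_opNorm v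
    _ = ‖P‖ * ‖v‖ ^ 2 := by ring

theorem norm_le_mul_exp_of_hasDerivAt {A : H →L[ℝ] H} {x : ℝ → H}
    (hx : ∀ s, HasDerivAt x (A (x s)) s) {a b : ℝ} (hab : a ≤ b) :
    ‖x b‖ ≤ ‖x a‖ * Real.exp (‖A‖ * (b - a)) := by
  have h := norm_le_gronwallBound_of_norm_deriv_right_le (f := x) (f' := fun s => A (x s))
    (δ := ‖x a‖) (K := ‖A‖) (ε := 0) (a := a) (b := b)
    (fun s _ => (hx s).continuousAt.continuousWithinAt)
    (fun s _ => (hx s).hasDerivWithinAt) le_rfl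
    (fun s _ => by simpa using A.le_opNorm (x s)) b ⟨hab, le_rfl⟩
  rwa [gronwallBound_ε0] at h

theorem exists_hasDerivAt_clm_apply [CompleteSpace H] (A : H →L[ℝ] H) (t : ℝ) (v : H) :
    ∃ x : ℝ → H, x t = v ∧ ∀ s, HasDerivAt x (A (x s)) s := by
  refine ⟨fun s => NormedSpace.exp ((s - t) • A) v, by simp, fun s => ?_⟩
  have h : HasDerivAt (fun u : ℝ => NormedSpace.exp (u • A))
      (A * NormedSpace.exp ((s - t) • A)) (s - t) := hasDerivAt_exp_smul_const' A (s - t)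
  simpa using (h.comp_sub_const s t).clm_apply (hasDerivAt_const s v)

end

/-- Uniform norm bound for solutions of the backward operator Riccati
differential equation on a real Hilbert space. -/
theorem stmt_0
    {H : Type*} [NormedAddCommGroup H] [InnerProductSpace ℝ H] [CompleteSpace H]
    (A B M MT R Rinv : H →L[ℝ] H)
    (hM : IsSelfAdjoint M) (hMpos : ∀ v : H, 0 ≤ ⟪M v, v⟫)
    (hMT : IsSelfAdjoint MT) (hMTpos : ∀ v : H, 0 ≤ ⟪MT v, v⟫)
    (hR : IsSelfAdjoint R) (r : ℝ) (hr : 0 < r)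
    (hRlb : ∀ v : H, r * ‖v‖ ^ 2 ≤ ⟪R v, v⟫)
    (hRinv₁ : R.comp Rinv = ContinuousLinearMap.id ℝ H)
    (hRinv₂ : Rinv.comp R = ContinuousLinearMap.id ℝ H)
    (T : ℝ) (hT : 0 < T)
    (S : ℝ → H →L[ℝ] H)
    (hSsa : ∀ t ∈ Set.Icc (0 : ℝ) T, IsSelfAdjoint (S t))
    (hSpos : ∀ t ∈ Set.Icc (0 : ℝ) T, ∀ v : H, 0 ≤ ⟪S t v, v⟫)
    (hderiv : ∀ t ∈ Set.Icc (0 : ℝ) T,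
      HasDerivWithinAt S
        (-((adjoint A).comp (S t) + (S t).comp A
            - (S t).comp (B.comp (Rinv.comp ((adjoint B).comp (S t)))) + M))
        (Set.Icc (0 : ℝ) T) t)
    (hterm : S T = MT) :
    ∀ t ∈ Set.Icc (0 : ℝ) T,
      ‖S t‖ ≤ (2 * ‖MT‖ + 2 * (T - t) * ‖M‖) * Real.exp (4 * (T - t) * ‖A‖) := by
  have hRinv : ∀ w : H, 0 ≤ ⟪Rinv w, w⟫ := fun w => by
    have h := hRlb (Rinv w)
    rw [← comp_apply, hRinv₁, id_apply, real_inner_comm] at h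
    exact le_trans (by positivity) h
  intro t ht
  have hTt : 0 ≤ T - t := sub_nonneg.2 ht.2
  set E := Real.exp (‖A‖ * (T - t)) with hE
  have hbound : ‖S t‖ ≤ (‖MT‖ + (T - t) * ‖M‖) * E ^ 2 := by
    refine norm_le_of_isSymmetric_of_inner_le (hSsa t ht).isSymmetric (hSpos t ht)
      (by positivity) fun v => ?_
    obtain ⟨x, hxt, hx⟩ := exists_hasDerivAt_clm_apply A t v
    have hxle : ∀ s ∈ Set.Icc t T, ‖x s‖ ^ 2 ≤ E ^ 2 * ‖v‖ ^ 2 := fun s hs => by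
      rw [← mul_pow]
      gcongr
      calc ‖x s‖ ≤ ‖x t‖ * Real.exp (‖A‖ * (s - t)) := norm_le_mul_exp_of_hasDerivAt hx hs.1
        _ ≤ E * ‖v‖ := by
          rw [hxt, mul_comm, hE]
          gcongr
          exact hs.2
    have hsub : Set.Icc t T ⊆ Set.Icc 0 T := Set.Icc_subset_Icc_left ht.1
    have hg : ∀ s ∈ Set.Icc t T, HasDerivWithinAt
        (fun s => ⟪S s (x s), x s⟫ + s * (‖M‖ * (E ^ 2 * ‖v‖ ^ 2)))
        (⟪Rinv (adjoint B (S s (x s))), adjoint B (S s (x s))⟫ - ⟪M (x s), x s⟫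
          + ‖M‖ * (E ^ 2 * ‖v‖ ^ 2)) (Set.Icc t T) s := fun s hs => by
      have hx' := (hx s).hasDerivWithinAt (s := Set.Icc t T)
      have h := ((((hderiv s (hsub hs)).mono hsub).clm_apply hx').inner ℝ hx').add
        ((hasDerivWithinAt_id s (Set.Icc t T)).mul_const (‖M‖ * (E ^ 2 * ‖v‖ ^ 2)))
      refine h.congr_deriv ?_
      have hsymm : ∀ y z : H, ⟪S s y, z⟫ = ⟪y, S s z⟫ := (hSsa s (hsub hs)).isSymmetric
      simp only [neg_apply, add_apply, sub_apply, comp_apply, inner_add_left, inner_sub_left,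
        inner_neg_left, adjoint_inner_left, adjoint_inner_right, hsymm, one_mul]
      ring
    have hmono : MonotoneOn (fun s => ⟪S s (x s), x s⟫ + s * (‖M‖ * (E ^ 2 * ‖v‖ ^ 2)))
        (Set.Icc t T) := by
      refine monotoneOn_of_hasDerivWithinAt_nonneg (convex_Icc t T)
        (fun s hs => (hg s hs).continuousWithinAt)
        (fun s hs => (hg s (interior_subset hs)).mono interior_subset) fun s hs => ?_
      have hs' := interior_subset hs
      have h₁ := hRinv (adjoint B (S s (x s)))
      have h₂ := (inner_clm_apply_self_le M (x s)).trans
        (mul_le_mul_of_nonneg_left (hxle s hs') (norm_nonneg M))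
      linarith
    have hends := hmono (Set.left_mem_Icc.2 ht.2) (Set.right_mem_Icc.2 ht.2) ht.2
    simp only [hxt, hterm] at hends
    have hMTle := (inner_clm_apply_self_le MT (x T)).trans
      (mul_le_mul_of_nonneg_left (hxle T (Set.right_mem_Icc.2 ht.2)) (norm_nonneg MT))
    linarith
  have hE1 : 1 ≤ E := Real.one_le_exp (by positivity)
  have hE4 : Real.exp (4 * (T - t) * ‖A‖) = E ^ 4 := by
    rw [hE, ← Real.exp_nat_mul]
    congr 1
    push_cast
    ring
  rw [hE4]
  calc ‖S t‖ ≤ (‖MT‖ + (T - t) * ‖M‖) * E ^ 2 := hbound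
    _ ≤ (2 * ‖MT‖ + 2 * (T - t) * ‖M‖) * E ^ 4 := by
      have h₁ : 0 ≤ (T - t) * ‖M‖ := by positivity
      have h₂ := norm_nonneg MT
      gcongr
      · linarith
      · linarith
      · norm_num
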